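/- Let K be an algebraically closed field of characteristic 0 and let R be a standard Artinian Gorenstein K-algebra with socle in degree N ≥ 2 and codimension dim_K R¹ ≤ 4. Then there exists x ∈ R¹ such that the multiplication map x^{N−2}· : R¹ → R^{N−1} is an isomorphism of K-vector spaces (the strong Lefschetz property holds in degree 1). -/

import Mathlib

namespace GordanNoether

open MvPolynomial

variable {K : Type*} [Field K] {ι : Type*}

theorem derivation_aeval {κ : Type*} [Fintype κ]
    (D : Derivation K (MvPolynomial ι K) (MvPolynomial ι K))
    (f : κ → MvPolynomial ι K) (g : MvPolynomial κ K) :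
    D (aeval f g) = ∑ k, aeval f (pderiv k g) * D (f k) := by
  classical
  induction g using MvPolynomial.induction_on with
  | C a => simp
  | add p q hp hq => simp only [map_add, hp, hq, add_mul, Finset.sum_add_distrib]
  | mul_X p j hp =>
    simp only [map_mul, aeval_X, Derivation.leibniz, hp, pderiv_X, smul_eq_mul, map_add,
      add_mul, Finset.sum_add_distrib, Finset.mul_sum]
    congr 1
    · rw [Finset.sum_eq_single j] <;> simp +contextual [eq_comm]
    · exact Finset.sum_congr rfl fun _ _ => by ring

theorem mkDerivation_eq_sum [Fintype ι] (h : ι → MvPolynomial ι K) (f : MvPolynomial ι K) :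
    mkDerivation K h f = ∑ i, h i * pderiv i f := by
  simpa [mkDerivation_X, mul_comm] using derivation_aeval (mkDerivation K h) X f

theorem totalDegree_pderiv_le (i : ι) (f : MvPolynomial ι K) :
    (pderiv i f).totalDegree ≤ f.totalDegree - 1 := by
  classical
  refine Finset.sup_le fun m hm => ?_
  rw [mem_support_iff, coeff_pderiv] at hm
  have := le_totalDegree (mem_support_iff.2 (left_ne_zero_of_mul hm))
  have h2 := Finsupp.sum_add_index' (f := m) (g := Finsupp.single i 1) (h := fun _ e => e)
    (fun _ => rfl) (fun _ _ _ => rfl)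
  rw [Finsupp.sum_single_index rfl] at h2
  omega

theorem totalDegree_directional_le [Fintype ι] (w : ι → K) (f : MvPolynomial ι K) :
    (∑ i, C (w i) * pderiv i f).totalDegree ≤ f.totalDegree - 1 := by
  refine totalDegree_finsetSum_le fun i _ => ?_
  exact (totalDegree_mul _ _).trans (by simpa using totalDegree_pderiv_le i f)

/-- A polynomial dividing its own derivative in a constant direction, or that of a polynomial of no
larger degree, makes this derivative vanish. -/
theorem directional_eq_zero_of_dvd [Fintype ι] {w : ι → K} {p f : MvPolynomial ι K}
    (hp : p.totalDegree ≠ 0) (hdeg : f.totalDegree ≤ p.totalDegree)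
    (hdvd : p ∣ ∑ i, C (w i) * pderiv i f) : ∑ i, C (w i) * pderiv i f = 0 := by
  by_contra hne
  have h1 := totalDegree_le_of_dvd_of_isDomain hdvd hne
  have h2 := totalDegree_directional_le w f
  omega

/-- The flow `x ↦ x + T h(x)`. -/
noncomputable def flow (h : ι → MvPolynomial ι K) :
    MvPolynomial ι K →ₐ[K] Polynomial (MvPolynomial ι K) :=
  aeval fun i => Polynomial.C (X i) + Polynomial.X * Polynomial.C (h i)

theorem coeff_flow_succ {h : ι → MvPolynomial ι K} (hh : ∀ i, mkDerivation K h (h i) = 0)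
    (f : MvPolynomial ι K) (k : ℕ) :
    ((k : MvPolynomial ι K) + 1) * (flow h f).coeff (k + 1) =
      mkDerivation K h ((flow h f).coeff k) := by
  induction f using MvPolynomial.induction_on generalizing k with
  | C a =>
    have : flow h (C a) = Polynomial.C (C a) := by
      simp only [flow, algHom_C]; rfl
    rw [this]
    cases k <;> simp [Polynomial.coeff_C]
  | add p q hp hq => simp [mul_add, hp, hq]
  | mul_X p j hp =>
    have e : flow h (p * X j) = flow h p * Polynomial.C (X j)
        + flow h p * Polynomial.C (h j) * Polynomial.X := by
      simp only [flow, map_mul, aeval_X]; ring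
    rw [e]
    cases k with
    | zero =>
      have := hp 0
      simp only [Polynomial.coeff_add, Polynomial.coeff_mul_C, Polynomial.coeff_mul_X,
        Polynomial.coeff_mul_X_zero, Derivation.leibniz, mkDerivation_X, smul_eq_mul, map_add,
        map_zero, zero_add, Nat.cast_zero, one_mul] at this ⊢
      rw [this]; ring
    | succ k =>
      have h1 := hp k
      have h2 := hp (k + 1)
      simp only [Polynomial.coeff_add, Polynomial.coeff_mul_C, Polynomial.coeff_mul_X,
        Derivation.leibniz, mkDerivation_X, hh, smul_eq_mul, map_add, Nat.cast_succ] at h1 h2 ⊢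
      rw [← h2, ← h1]; ring

theorem coeff_flow_zero (h : ι → MvPolynomial ι K) (f : MvPolynomial ι K) :
    (flow h f).coeff 0 = f := by
  induction f using MvPolynomial.induction_on with
  | C a =>
    have : flow h (C a) = Polynomial.C (C a) := by
      simp only [flow, algHom_C]; rfl
    simp [this]
  | add p q hp hq => simp [hp, hq]
  | mul_X p j hp =>
    rw [map_mul, Polynomial.mul_coeff_zero, hp]
    simp [flow]

theorem flow_eq_C [CharZero K] {h : ι → MvPolynomial ι K} (hh : ∀ i, mkDerivation K h (h i) = 0)
    {f : MvPolynomial ι K} (hf : mkDerivation K h f = 0) : flow h f = Polynomial.C f := by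
  have key : ∀ k, (flow h f).coeff (k + 1) = 0 := by
    intro k
    have e := coeff_flow_succ hh f k
    have hk : ((k : MvPolynomial ι K) + 1) ≠ 0 := Nat.cast_add_one_ne_zero k
    have : mkDerivation K h ((flow h f).coeff k) = 0 := by
      cases k with
      | zero => rw [coeff_flow_zero, hf]
      | succ k =>
        have e' := coeff_flow_succ hh f k
        induction k with
        | zero =>
          rw [coeff_flow_zero, hf] at e'
          simp only [Nat.cast_zero, zero_add, one_mul] at e'
          simp [e']
        | succ k ih =>
          have e'' := coeff_flow_succ hh f k
          rw [ih (coeff_flow_succ hh f _) (Nat.cast_add_one_ne_zero _) e''] at e'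
          rw [(mul_eq_zero.1 e').resolve_left (Nat.cast_add_one_ne_zero _), map_zero]
    rw [this] at e
    exact (mul_eq_zero.1 e).resolve_left hk
  ext1 k
  cases k with
  | zero => simp [coeff_flow_zero]
  | succ k => simp [key]

/-- The kernel of `∑ h i ∂ᵢ` is factorially closed. -/
theorem derivation_eq_zero_of_mul [CharZero K] {h : ι → MvPolynomial ι K}
    (hh : ∀ i, mkDerivation K h (h i) = 0) {f g : MvPolynomial ι K}
    (hfg : mkDerivation K h (f * g) = 0) (hne : f * g ≠ 0) : mkDerivation K h f = 0 := by
  have e := flow_eq_C hh hfg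
  rw [map_mul] at e
  have hne' : flow h f * flow h g ≠ 0 := by simpa [e] using hne
  have hd := congrArg Polynomial.natDegree e
  rw [Polynomial.natDegree_mul (left_ne_zero_of_mul hne') (right_ne_zero_of_mul hne'),
    Polynomial.natDegree_C] at hd
  have := coeff_flow_succ hh f 0
  rw [coeff_flow_zero, Polynomial.coeff_eq_zero_of_natDegree_lt (by omega)] at this
  simpa using this.symm

theorem derivation_eq_zero_of_dvd [CharZero K] {h : ι → MvPolynomial ι K}
    (hh : ∀ i, mkDerivation K h (h i) = 0) {f g : MvPolynomial ι K}
    (hg : mkDerivation K h g = 0) (hne : g ≠ 0) (hdvd : f ∣ g) : mkDerivation K h f = 0 := by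
  obtain ⟨q, rfl⟩ := hdvd
  exact derivation_eq_zero_of_mul hh hg hne

/-- A homogeneous polynomial of positive degree in the kernel of `∑ h i ∂ᵢ` vanishes at `h`. -/
theorem aeval_eq_zero_of_derivation_eq_zero [CharZero K] {h : ι → MvPolynomial ι K}
    (hh : ∀ i, mkDerivation K h (h i) = 0) {f : MvPolynomial ι K} {m : ℕ} (hm : 0 < m)
    (hf : f.IsHomogeneous m) (hDf : mkDerivation K h f = 0) : aeval h f = 0 := by
  have key : (flow h f).coeff m = aeval h f := by
    conv_lhs => rw [flow, aeval_def, eval₂_eq]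
    rw [aeval_def, eval₂_eq, Polynomial.finsetSum_coeff]
    refine Finset.sum_congr rfl fun d hd => ?_
    have hdeg : m = ∑ i ∈ d.support, d i := hf.degree_eq_sum_deg_support hd
    have hC : (algebraMap K (Polynomial (MvPolynomial ι K))) (coeff d f)
        = Polynomial.C (C (coeff d f)) := rfl
    rw [hC, Polynomial.coeff_C_mul]
    congr 1
    rw [hdeg]
    have gen : ∀ s : Finset ι,
        (∏ i ∈ s, (Polynomial.C (X i) + Polynomial.X * Polynomial.C (h i)) ^ d i).natDegree
          ≤ ∑ i ∈ s, d i ∧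
        (∏ i ∈ s, (Polynomial.C (X i) + Polynomial.X * Polynomial.C (h i)) ^ d i).coeff
          (∑ i ∈ s, d i) = ∏ i ∈ s, h i ^ d i := by
      classical
      intro s
      induction s using Finset.induction_on with
      | empty => simp
      | insert a s ha ih =>
        have h1 : (Polynomial.C (X a : MvPolynomial ι K)
            + Polynomial.X * Polynomial.C (h a)).natDegree ≤ 1 := by compute_degree
        have h2 := Polynomial.natDegree_pow_le_of_le (d a) h1
        have h3 := Polynomial.coeff_pow_of_natDegree_le (m := d a) h1
        rw [mul_one] at h2 h3
        rw [Finset.prod_insert ha, Finset.sum_insert ha, Finset.prod_insert ha]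
        refine ⟨Polynomial.natDegree_mul_le_of_le h2 ih.1, ?_⟩
        rw [Polynomial.coeff_mul_add_eq_of_natDegree_le h2 ih.1, ih.2, h3]
        simp
    exact (gen _).2
  rw [← key, flow_eq_C hh hDf, Polynomial.coeff_C, if_neg hm.ne']

/-- The substitution `X i ↦ T X i` separates homogeneous components. -/
theorem exists_algHom_coeff_eq_homogeneousComponent :
    ∃ θ : MvPolynomial ι K →ₐ[K] Polynomial (MvPolynomial ι K),
      ∀ p k, (θ p).coeff k = homogeneousComponent k p := by
  let θ : MvPolynomial ι K →ₐ[K] Polynomial (MvPolynomial ι K) :=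
    aeval fun i => Polynomial.X * Polynomial.C (X i)
  refine ⟨θ, ?_⟩
  intro p k
  induction p using MvPolynomial.induction_on' with
  | add p q hp hq => simp [hp, hq]
  | monomial d a =>
    have e : θ (monomial d a) = Polynomial.C (monomial d a) * Polynomial.X ^ d.degree := by
      have hC : (algebraMap K (Polynomial (MvPolynomial ι K))) a = Polynomial.C (C a) := rfl
      simp only [θ, aeval_monomial, hC, mul_pow, Finsupp.prod_mul]
      rw [monomial_eq, Polynomial.C_mul, map_finsuppProd, Finsupp.degree_apply,
        ← Finset.prod_pow_eq_pow_sum]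
      simp only [map_pow, Finsupp.prod]
      ring
    rw [e, Polynomial.coeff_C_mul, Polynomial.coeff_X_pow]
    have hm := isHomogeneous_monomial (R := K) a (rfl : d.degree = d.degree)
    rw [homogeneousComponent_of_mem hm]
    split_ifs <;> simp

/-- Factors of nonzero homogeneous polynomials are homogeneous. -/
theorem isHomogeneous_of_mul {f g : MvPolynomial ι K} {n : ℕ} (hfg : (f * g).IsHomogeneous n)
    (hne : f * g ≠ 0) : f.IsHomogeneous f.totalDegree := by
  obtain ⟨θ, hθ⟩ := exists_algHom_coeff_eq_homogeneousComponent (K := K) (ι := ι)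
  have hmul : θ f * θ g = Polynomial.C (f * g) * Polynomial.X ^ n := by
    rw [← map_mul]
    ext1 k
    rw [hθ, homogeneousComponent_of_mem hfg, Polynomial.coeff_C_mul, Polynomial.coeff_X_pow]
    split_ifs <;> simp
  have hne' : θ f * θ g ≠ 0 := by
    rw [hmul]
    exact mul_ne_zero (by simpa using hne) (pow_ne_zero _ Polynomial.X_ne_zero)
  have hf := left_ne_zero_of_mul hne'
  have hg := right_ne_zero_of_mul hne'
  have h1 := congrArg Polynomial.natDegree hmul
  have h2 := congrArg Polynomial.natTrailingDegree hmul
  rw [Polynomial.natDegree_mul hf hg, Polynomial.natDegree_C_mul_X_pow n _ hne] at h1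
  rw [Polynomial.natTrailingDegree_mul hf hg, Polynomial.C_mul_X_pow_eq_monomial,
    Polynomial.natTrailingDegree_monomial hne] at h2
  have h3 := Polynomial.natTrailingDegree_le_natDegree (θ f)
  have h4 := Polynomial.natTrailingDegree_le_natDegree (θ g)
  have hcomp : ∀ k, k ≠ (θ f).natDegree → homogeneousComponent k f = 0 := by
    intro k hk
    rw [← hθ]
    rcases lt_or_gt_of_ne hk with h | h
    · exact Polynomial.coeff_eq_zero_of_lt_natTrailingDegree (by omega)
    · exact Polynomial.coeff_eq_zero_of_natDegree_lt h
  have hf' : f.IsHomogeneous (θ f).natDegree := by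
    conv => enter [1]; rw [← sum_homogeneousComponent f]
    refine IsHomogeneous.sum _ _ _ fun k _ => ?_
    by_cases hk : k = (θ f).natDegree
    · exact hk ▸ homogeneousComponent_isHomogeneous _ _
    · rw [hcomp k hk]; exact isHomogeneous_zero _ _ _
  rwa [hf'.totalDegree (left_ne_zero_of_mul hne)]

theorem exists_isHomogeneous_relation {κ : Type*} {f : κ → MvPolynomial ι K} {d : ℕ} (hd : 0 < d)
    (hf : ∀ k, (f k).IsHomogeneous d) (hdep : ¬ AlgebraicIndependent K f) :
    ∃ m, ∃ Q : MvPolynomial κ K, Q.IsHomogeneous m ∧ Q ≠ 0 ∧ aeval f Q = 0 := by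
  rw [algebraicIndependent_iff] at hdep
  push Not at hdep
  obtain ⟨Q, hQ, hQ0⟩ := hdep
  have : ∃ m, homogeneousComponent m Q ≠ 0 := by
    by_contra! h
    exact hQ0 (by rw [← sum_homogeneousComponent Q]; exact Finset.sum_eq_zero fun i _ => h i)
  obtain ⟨m, hm⟩ := this
  refine ⟨m, _, homogeneousComponent_isHomogeneous m Q, hm, ?_⟩
  have hmem : m ∈ Finset.range (Q.totalDegree + 1) := by
    by_contra h
    exact hm (homogeneousComponent_eq_zero _ _ (by simpa [Nat.lt_succ_iff] using h))
  have e := congrArg (homogeneousComponent (d * m)) hQ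
  rw [← sum_homogeneousComponent Q, map_sum, map_sum, map_zero, Finset.sum_eq_single_of_mem m hmem]
    at e
  · rwa [homogeneousComponent_of_mem ((homogeneousComponent_isHomogeneous m Q).aeval f hf),
      if_pos rfl] at e
  · intro j _ hj
    rw [homogeneousComponent_of_mem ((homogeneousComponent_isHomogeneous j Q).aeval f hf),
      if_neg]
    intro h
    exact hj (Nat.eq_of_mul_eq_mul_left hd h).symm

theorem derivation_eq_zero_of_algebraicIndependent [CharZero K] [Fintype ι]
    {f : ι → MvPolynomial ι K} (hf : AlgebraicIndependent K f)
    (D : Derivation K (MvPolynomial ι K) (MvPolynomial ι K)) (hD : ∀ i, D (f i) = 0)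
    (x : MvPolynomial ι K) : D x = 0 := by
  have hb : IsTranscendenceBasis K f := hf.isTranscendenceBasis_of_lift_trdeg_le_of_finite
    (by rw [MvPolynomial.trdeg_of_isDomain]; simp)
  have halg := hb.isAlgebraic
  set A := Algebra.adjoin K (Set.range f) with hA
  have hDA : ∀ a ∈ A, D a = 0 := by
    intro a ha
    induction ha using Algebra.adjoin_induction with
    | mem x hx => obtain ⟨i, rfl⟩ := hx; exact hD i
    | algebraMap r => exact D.map_algebraMap r
    | add x y _ _ hx hy => rw [map_add, hx, hy, add_zero]
    | mul x y _ _ hx hy => simp [hx, hy]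
  let D' : Derivation A (MvPolynomial ι K) (MvPolynomial ι K) := Derivation.mk'
    { toFun := D
      map_add' := map_add D
      map_smul' := fun a y => by
        simp [Algebra.smul_def, hDA a a.2] } (fun a b => D.leibniz a b)
  have key : ∀ n, ∀ p : Polynomial A, p.natDegree = n → p ≠ 0 → Polynomial.aeval x p = 0 →
      D x = 0 := by
    intro n
    induction n with
    | zero =>
      intro p hp hp0 hpx
      rw [Polynomial.eq_C_of_natDegree_eq_zero hp, Polynomial.aeval_C] at hpx
      refine absurd ?_ hp0
      rw [Polynomial.eq_C_of_natDegree_eq_zero hp,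
        (FaithfulSMul.algebraMap_injective A (MvPolynomial ι K)) (hpx.trans (map_zero _).symm),
        Polynomial.C_0]
    | succ n ih =>
      intro p hp hp0 hpx
      have e := D'.map_aeval p x
      rw [hpx, map_zero, smul_eq_mul] at e
      rcases mul_eq_zero.1 e.symm with h | h
      · have : IsDomain A := inferInstance
        have : CharZero A := inferInstance
        refine ih p.derivative (by rw [Polynomial.natDegree_derivative, hp]; rfl) ?_ h
        intro h0
        have := Polynomial.derivative_eq_zero.1 h0
        omega
      · exact h
  obtain ⟨p, hp0, hpx⟩ := halg.isAlgebraic x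
  exact key _ p rfl hp0 hpx

/-- If the components of `h` are coprime and vanish at `h`, then the image of `h` has dimension at
most `card ι - 2`; here for `card ι ≤ 4`. -/
theorem not_algebraicIndependent_aeval [Fintype ι] (hcard : Fintype.card ι ≤ 4)
    {h : ι → MvPolynomial ι K} (hprim : ∀ c, (∀ i, c ∣ h i) → IsUnit c) {a : ι} (ha : h a ≠ 0)
    (hzero : ∀ k, aeval h (h k) = 0) (q : Fin 3 → MvPolynomial ι K) :
    ¬ AlgebraicIndependent K (fun j => aeval h (q j)) := by
  intro hind
  have hker : RingHom.ker (aeval h : MvPolynomial ι K →ₐ[K] _) ≠ ⊥ := by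
    intro hbot
    have : h a ∈ RingHom.ker (aeval h : MvPolynomial ι K →ₐ[K] _) := hzero a
    rw [hbot] at this
    exact ha this
  obtain ⟨π, hπmem, hπ⟩ := (RingHom.ker_isPrime
    (aeval h : MvPolynomial ι K →ₐ[K] MvPolynomial ι K)).exists_mem_prime_of_ne_bot hker
  obtain ⟨k, hk⟩ : ∃ k, ¬ π ∣ h k := by
    by_contra! hall
    exact hπ.not_isUnit (hprim π hall)
  have hprime : (Ideal.span {π}).IsPrime := (Ideal.span_singleton_prime hπ.ne_zero).2 hπ
  let B := MvPolynomial ι K ⧸ Ideal.span {π}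
  let mk : MvPolynomial ι K →ₐ[K] B := Ideal.Quotient.mkₐ K _
  let φ : B →ₐ[K] MvPolynomial ι K := Ideal.Quotient.liftₐ (Ideal.span {π}) (aeval h) (by
    intro x hx
    obtain ⟨c, rfl⟩ := Ideal.mem_span_singleton.1 hx
    rw [map_mul, show aeval h π = 0 from hπmem, zero_mul])
  have hφ : ∀ x, φ (mk x) = aeval h x := fun x => rfl
  have hq : AlgebraicIndependent K (fun j => mk (q j)) := AlgebraicIndependent.of_comp φ hind
  have hgen : Algebra.adjoin K (Set.range fun i => mk (X i)) = ⊤ := by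
    have : (Set.range fun i => mk (X i)) = mk '' Set.range X := by rw [← Set.range_comp]; rfl
    rw [this, ← AlgHom.map_adjoin, adjoin_range_X, Algebra.map_top, AlgHom.range_eq_top]
    exact Ideal.Quotient.mk_surjective
  have htr : Algebra.trdeg K B < (Fintype.card ι : Cardinal) := by
    by_contra! hle
    have : Algebra.IsAlgebraic (Algebra.adjoin K (Set.range fun i => mk (X i))) B := by
      rw [hgen]
      exact ⟨fun x => isAlgebraic_algebraMap (⟨x, trivial⟩ : (⊤ : Subalgebra K B))⟩
    have hb := Algebra.IsAlgebraic.isTranscendenceBasis_of_lift_le_trdeg_of_finite K (fun i => mk (X i))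
      (by simpa using hle)
    have e : aeval (fun i => mk (X i)) π = 0 := by
      have : aeval (fun i => mk (X i)) = mk := by ext i; simp
      rw [this]
      exact Ideal.Quotient.eq_zero_iff_mem.2 (Ideal.mem_span_singleton_self π)
    exact hπ.ne_zero ((algebraicIndependent_iff.1 hb.1) _ e)
  have htr3 : Algebra.trdeg K B ≤ 3 := by
    have h4 : Algebra.trdeg K B < (4 : ℕ) := htr.trans_le (by exact_mod_cast hcard)
    obtain ⟨n, hn⟩ := Cardinal.lt_aleph0.1 (h4.trans (Cardinal.natCast_lt_aleph0))
    rw [hn] at h4 ⊢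
    have : n < 4 := by exact_mod_cast h4
    have : n ≤ 3 := by omega
    exact_mod_cast this
  have hb := hq.isTranscendenceBasis_of_lift_trdeg_le_of_finite (by simpa using htr3)
  have halg := hb.isAlgebraic
  have hk0 : mk (h k) ≠ 0 := by
    intro h0
    exact hk (Ideal.mem_span_singleton.1 (Ideal.Quotient.eq_zero_iff_mem.1 h0))
  have hne := Ideal.comap_ne_bot_of_algebraic_mem (I := RingHom.ker φ) hk0 (hzero k)
    (halg.isAlgebraic (mk (h k)))
  refine hne ((Submodule.eq_bot_iff _).2 ?_)
  rintro ⟨b, hb⟩ hbφ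
  rw [Algebra.adjoin_range_eq_range_aeval] at hb
  obtain ⟨g, rfl⟩ := hb
  have e : aeval (fun j => aeval h (q j)) g = 0 := by
    have h1 : φ (aeval (fun j => mk (q j)) g) = 0 := hbφ
    rw [← h1, ← AlgHom.comp_apply, comp_aeval]
    rfl
  have hg := (algebraicIndependent_iff.1 hind) _ e
  ext
  simp [hg]

theorem aeval_mul_eq_pow_mul {A κ : Type*} [CommRing A] [Algebra K A] {Q : MvPolynomial κ K} {m : ℕ}
    (hQ : Q.IsHomogeneous m) (r : A) (g : κ → A) :
    aeval (fun i => r * g i) Q = r ^ m * aeval g Q := by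
  simp only [aeval_def, eval₂_eq, Finset.mul_sum, mul_pow, Finset.prod_mul_distrib,
    Finset.prod_pow_eq_pow_sum]
  refine Finset.sum_congr rfl fun d hd => ?_
  rw [hQ.degree_eq_sum_deg_support hd]
  ring

theorem X_zero_dvd_of_aeval_eq_zero [Infinite K] {Q : MvPolynomial (Fin 3) K} {m : ℕ}
    (hQ : Q.IsHomogeneous m)
    (h0 : aeval ![(0 : Polynomial K), 1, Polynomial.X] Q = 0) : X 0 ∣ Q := by
  have hG : aeval ![(0 : MvPolynomial (Fin 3) K), X 1, X 2] Q = 0 := by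
    have : (X 1 : MvPolynomial (Fin 3) K) * aeval ![(0 : MvPolynomial (Fin 3) K), X 1, X 2] Q = 0 := by
      refine MvPolynomial.funext fun x => ?_
      rw [map_mul, eval_X, map_zero]
      by_cases hx : x 1 = 0
      · rw [hx, zero_mul]
      have e1 : eval x (aeval ![(0 : MvPolynomial (Fin 3) K), X 1, X 2] Q) =
          aeval ![(0 : K), x 1, x 2] Q := by
        rw [← coe_aeval_eq_eval, RingHom.coe_coe, ← AlgHom.comp_apply, comp_aeval]
        congr 2
        ext i; fin_cases i <;> simp
      have e2 : aeval ![(0 : K), 1, x 2 / x 1] Q = 0 := by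
        have := congrArg (Polynomial.aeval (x 2 / x 1)) h0
        rw [← AlgHom.comp_apply, comp_aeval, map_zero] at this
        refine Eq.trans ?_ this
        congr 2
        ext i; fin_cases i <;> simp
      have e3 := aeval_mul_eq_pow_mul hQ (x 1) ![(0 : K), 1, x 2 / x 1]
      rw [e2, mul_zero] at e3
      refine mul_eq_zero_of_right _ (Eq.trans ?_ e3)
      rw [e1]
      congr 2
      ext i; fin_cases i <;> simp [mul_div_cancel₀, hx]
    exact (mul_eq_zero.1 this).resolve_left (X_ne_zero _)
  rw [← Ideal.mem_span_singleton, ← Ideal.Quotient.eq_zero_iff_mem]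
  have e : (Ideal.Quotient.mkₐ K (Ideal.span {(X 0 : MvPolynomial (Fin 3) K)})).comp
      (aeval ![(0 : MvPolynomial (Fin 3) K), X 1, X 2]) = Ideal.Quotient.mkₐ K _ := by
    ext i
    fin_cases i
    · simp
    · simp
    · simp
  have := congrArg (fun φ => φ Q) e
  simp only [AlgHom.comp_apply, hG, map_zero] at this
  exact this.symm

theorem exists_dvd_sub_of_relation [IsAlgClosed K] {π p u v : MvPolynomial ι K} {d : ℕ}
    (hd : 0 < d) (hp : p.IsHomogeneous d) (hu : u.IsHomogeneous d) (hv : v.IsHomogeneous d)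
    (hp0 : p ≠ 0) (hπ : Prime π) (hπp : π ∣ p) (hπu : ¬ π ∣ u)
    (hdep : ¬ AlgebraicIndependent K ![p, u, v]) : ∃ e : K, π ∣ v - C e * u := by
  classical
  have hrel := exists_isHomogeneous_relation hd (f := ![p, u, v])
    (by intro k; fin_cases k <;> simpa) hdep
  obtain ⟨Q, hQ, hQ0, hQp⟩ := Nat.find_spec hrel
  have hX : ¬ X 0 ∣ Q := by
    rintro ⟨Q', hQ'⟩
    have hQ'0 : Q' ≠ 0 := by rintro rfl; simp [hQ'] at hQ0
    have hdeg : Q.totalDegree = 1 + Q'.totalDegree := by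
      rw [hQ', totalDegree_mul_of_isDomain (X_ne_zero _) hQ'0, totalDegree_X]
    rw [hQ.totalDegree hQ0] at hdeg
    refine Nat.find_min hrel (m := Q'.totalDegree) (by omega) ⟨Q', ?_, hQ'0, ?_⟩
    · refine isHomogeneous_of_mul (g := X 0) (n := Nat.find hrel) ?_ ?_
      · rwa [mul_comm, ← hQ']
      · rwa [mul_comm, ← hQ']
    · rw [hQ', map_mul, aeval_X] at hQp
      exact (mul_eq_zero.1 hQp).resolve_left hp0
  have hprime : (Ideal.span {π}).IsPrime := (Ideal.span_singleton_prime hπ.ne_zero).2 hπ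
  let B := MvPolynomial ι K ⧸ Ideal.span {π}
  let L := FractionRing B
  let mk : MvPolynomial ι K →ₐ[K] L :=
    (IsScalarTower.toAlgHom K B L).comp (Ideal.Quotient.mkₐ K (Ideal.span {π}))
  have hmk : ∀ x, mk x = 0 ↔ π ∣ x := by
    intro x
    rw [← Ideal.mem_span_singleton, ← Ideal.Quotient.eq_zero_iff_mem]
    exact (IsFractionRing.injective B L).eq_iff' (map_zero _)
  have hu0 : mk u ≠ 0 := fun h => hπu ((hmk u).1 h)
  have e1 : aeval ![(0 : L), 1, mk v / mk u] Q = 0 := by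
    have e := congrArg mk hQp
    rw [← AlgHom.comp_apply, comp_aeval, map_zero] at e
    have e3 := aeval_mul_eq_pow_mul hQ (mk u) ![(0 : L), 1, mk v / mk u]
    have : (fun i => mk u * ![(0 : L), 1, mk v / mk u] i) = fun i => mk (![p, u, v] i) := by
      ext i
      fin_cases i
      · simp [(hmk p).2 hπp]
      · simp
      · simp [mul_div_cancel₀, hu0]
    rw [this, e] at e3
    exact (mul_eq_zero.1 e3.symm).resolve_left (pow_ne_zero _ hu0)
  have halg : IsAlgebraic K (mk v / mk u) := by
    refine ⟨aeval ![(0 : Polynomial K), 1, Polynomial.X] Q, ?_, ?_⟩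
    · exact fun h => hX (X_zero_dvd_of_aeval_eq_zero hQ h)
    · rw [← AlgHom.comp_apply, comp_aeval, ← e1]
      congr 2
      ext i; fin_cases i <;> simp
  obtain ⟨e, he⟩ := minpoly.mem_range_of_degree_eq_one K (mk v / mk u)
    (IsAlgClosed.degree_eq_one_of_irreducible K (minpoly.irreducible halg.isIntegral))
  refine ⟨e, (hmk _).1 ?_⟩
  rw [map_sub, map_mul, sub_eq_zero, ← algebraMap_eq, AlgHom.commutes]
  exact (eq_div_iff hu0).1 he |>.symm

theorem exists_prime_dvd_eval_eq_zero {p : MvPolynomial ι K} (hp : p ≠ 0) {y : ι → K}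
    (hy : eval y p = 0) : ∃ π, Prime π ∧ π ∣ p ∧ eval y π = 0 := by
  obtain ⟨s, hs, u, hu⟩ := UniqueFactorizationMonoid.exists_prime_factors p hp
  have e : (s.map (eval y)).prod = 0 := by
    rw [← map_multiset_prod]
    rw [← hu, map_mul] at hy
    exact (mul_eq_zero.1 hy).resolve_right ((u.isUnit.map (eval y)).ne_zero)
  obtain ⟨π, hπs, hπ⟩ := Multiset.mem_map.1 (Multiset.prod_eq_zero_iff.1 e)
  exact ⟨π, hs π hπs, (Multiset.dvd_prod hπs).trans ⟨u, hu.symm⟩, hπ⟩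

/-- Through a point `y` with `h a y ≠ 0` there passes an irreducible hypersurface on which the ratios
of the components of `h` are constant. -/
theorem exists_prime_fiber [IsAlgClosed K] [Fintype ι] (hcard : Fintype.card ι ≤ 4)
    {h : ι → MvPolynomial ι K} (hprim : ∀ c, (∀ i, c ∣ h i) → IsUnit c)
    {d : ℕ} (hd : 0 < d) (hhom : ∀ i, (h i).IsHomogeneous d)
    (hzero : ∀ k, aeval h (h k) = 0) {a b : ι} (hab : ∀ e : K, h b ≠ C e * h a)
    {y : ι → K} (hy : eval y (h a) ≠ 0) :
    ∃ π, Prime π ∧ eval y π = 0 ∧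
      ∀ i, π ∣ h i * C (eval y (h a)) - C (eval y (h i)) * h a := by
  have ha : h a ≠ 0 := by rintro h0; simp [h0] at hy
  set p := h b * C (eval y (h a)) - C (eval y (h b)) * h a with hpdef
  have hp0 : p ≠ 0 := by
    intro h0
    refine hab (eval y (h b) / eval y (h a)) ?_
    have hC : C (eval y (h a)) ≠ (0 : MvPolynomial ι K) := by simpa using hy
    refine mul_right_cancel₀ hC ?_
    rw [sub_eq_zero.1 h0, mul_right_comm, ← C_mul, div_mul_cancel₀ _ hy]
  have hphom : p.IsHomogeneous d := by
    refine IsHomogeneous.sub ?_ ((hhom a).C_mul _)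
    rw [mul_comm]
    exact (hhom b).C_mul _
  obtain ⟨π, hπ, hπp, hπy⟩ := exists_prime_dvd_eval_eq_zero hp0 (y := y) (by simp [p, mul_comm])
  have hπa : ¬ π ∣ h a := by
    rintro ⟨c, hc⟩
    rw [hc, map_mul, hπy, zero_mul] at hy
    exact hy rfl
  refine ⟨π, hπ, hπy, fun i => ?_⟩
  have hdep : ¬ AlgebraicIndependent K ![p, h a, h i] := by
    have := not_algebraicIndependent_aeval hcard hprim ha hzero
      ![X b * C (eval y (h a)) - C (eval y (h b)) * X a, X a, X i]
    convert this using 2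
    ext1 j
    fin_cases j <;> simp [p, algebraMap_eq]
  obtain ⟨e, g, he⟩ := exists_dvd_sub_of_relation hd hphom (hhom a) (hhom i) hp0 hπ hπp hπa hdep
  have hei : eval y (h i) = e * eval y (h a) := by
    have := congrArg (eval y) he
    rw [map_mul, hπy, zero_mul, map_sub, map_mul, eval_C] at this
    exact sub_eq_zero.1 this
  refine ⟨g * C (eval y (h a)), ?_⟩
  rw [hei, ← mul_assoc, ← he, C_mul]
  ring

theorem dvd_of_forall_dvd_mul [Fintype ι] {h : ι → MvPolynomial ι K}
    (hprim : ∀ c, (∀ i, c ∣ h i) → IsUnit c) {x e : MvPolynomial ι K} (hx : ∀ i, x ∣ h i * e) :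
    x ∣ e := by
  classical
  let _ := UniqueFactorizationMonoid.strongNormalizationMonoid (α := MvPolynomial ι K)
  let _ := UniqueFactorizationMonoid.toNormalizedGCDMonoid (MvPolynomial ι K)
  have hu : IsUnit (Finset.univ.gcd h) := hprim _ fun i => Finset.gcd_dvd (Finset.mem_univ i)
  exact hu.dvd_mul_left.1 ((Finset.gcd_mul_right' Finset.univ h e).dvd_iff_dvd_right.1
    (Finset.dvd_gcd fun i _ => hx i))

theorem totalDegree_ne_zero_of_prime {π : MvPolynomial ι K} (hπ : Prime π) {y : ι → K}
    (hy : eval y π = 0) : π.totalDegree ≠ 0 := by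
  intro h0
  rw [totalDegree_eq_zero_iff_eq_C.1 h0, eval_C] at hy
  rw [totalDegree_eq_zero_iff_eq_C.1 h0, hy, C_0] at hπ
  exact hπ.ne_zero rfl

/-- The derivative in a constant direction. -/
noncomputable abbrev directional (w : ι → K) :
    Derivation K (MvPolynomial ι K) (MvPolynomial ι K) :=
  mkDerivation K fun i => C (w i)

/-- The polynomials `h` are constant along the direction `h y`, for every point `y`. -/
theorem sum_eval_pderiv_mul_eq_zero [IsAlgClosed K] [CharZero K] [Fintype ι]
    (hcard : Fintype.card ι ≤ 4) {h : ι → MvPolynomial ι K}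
    (hprim : ∀ c, (∀ i, c ∣ h i) → IsUnit c) (hh : ∀ i, mkDerivation K h (h i) = 0)
    {d : ℕ} (hd : 0 < d) (hhom : ∀ i, (h i).IsHomogeneous d) {a b : ι} (ha : h a ≠ 0)
    (hab : ∀ e : K, h b ≠ C e * h a) (z : ι → K) (i : ι) :
    ∑ j, C (eval z (pderiv j (h i))) * h j = 0 := by
  have hzero : ∀ k, aeval h (h k) = 0 := fun k =>
    aeval_eq_zero_of_derivation_eq_zero hh hd (hhom k) (hh k)
  set q : (ι → K) → ι → MvPolynomial ι K :=
    fun z i => ∑ j, C (eval z (pderiv j (h i))) * h j with hq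
  set w : (ι → K) → ι → K := fun y i => eval y (h i) with hw
  have hqw : ∀ y z i, eval y (q z i) = eval z (directional (w y) (h i)) := by
    intro y z i
    simp [hq, hw, mkDerivation_eq_sum, mul_comm]
  set Fib : (ι → K) → MvPolynomial ι K → Prop := fun y π => w y a ≠ 0 ∧ Prime π ∧ eval y π = 0 ∧
      ∀ i, π ∣ h i * C (w y a) - C (w y i) * h a with hFib
  have hFib_ex : ∀ y, w y a ≠ 0 → ∃ π, Fib y π := fun y hy => by
    obtain ⟨π, h1, h2, h3⟩ := exists_prime_fiber hcard hprim hd hhom hzero hab hy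
    exact ⟨π, hy, h1, h2, h3⟩
  have hb0 : ∀ y, w y a ≠ 0 → h b * C (w y a) - C (w y b) * h a ≠ 0 := by
    intro y hy h0
    refine hab (w y b / w y a) ?_
    have hC : C (w y a) ≠ (0 : MvPolynomial ι K) := by simpa using hy
    refine mul_right_cancel₀ hC ?_
    rw [sub_eq_zero.1 h0, mul_right_comm, ← C_mul, div_mul_cancel₀ _ hy]
  have hDπ : ∀ y π, Fib y π → mkDerivation K h π = 0 := by
    rintro y π ⟨hy, -, -, h3⟩
    refine derivation_eq_zero_of_dvd hh ?_ (hb0 y hy) (h3 b)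
    simp [hh, derivation_C]
  have hdegπ : ∀ y π, Fib y π → π.totalDegree ≤ d := by
    rintro y π ⟨hy, -, -, h3⟩
    refine (totalDegree_le_of_dvd_of_isDomain (h3 b) (hb0 y hy)).trans (IsHomogeneous.totalDegree_le ?_)
    refine IsHomogeneous.sub ?_ ((hhom a).C_mul _)
    rw [mul_comm]
    exact (hhom b).C_mul _
  have hgood : ∀ y, w y a ≠ 0 → ∀ i, directional (w y) (h i) = 0 := by
    by_contra! hbad
    obtain ⟨y₀, hy₀, hi₀⟩ := hbad
    set A : Set ℕ := {n | ∃ y π, Fib y π ∧ (∃ i, directional (w y) (h i) ≠ 0) ∧ π.totalDegree = n}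
      with hA
    have hAne : A.Nonempty := by
      obtain ⟨π, hπ⟩ := hFib_ex y₀ hy₀
      exact ⟨_, y₀, π, hπ, hi₀, rfl⟩
    have hAb : BddAbove A := ⟨d, by rintro n ⟨y, π, hπ, -, rfl⟩; exact hdegπ y π hπ⟩
    obtain ⟨y, π, hπ, ⟨i₀, hi₀⟩, hmax⟩ := Nat.sSup_mem hAne hAb
    have hmax' : ∀ y' π', Fib y' π' → (∃ i, directional (w y') (h i) ≠ 0) →
        π'.totalDegree ≤ π.totalDegree := fun y' π' h1 h2 =>
      hmax ▸ le_csSup hAb ⟨y', π', h1, h2, rfl⟩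
    have hya : w y a ≠ 0 := hπ.1
    have hπa : ¬ π ∣ h a := by
      rintro ⟨c, hc⟩
      apply hya
      simp only [hw]
      rw [hc, map_mul, hπ.2.2.1, zero_mul]
    have hDw : ∀ y' π', Fib y' π' → (∃ i, directional (w y') (h i) ≠ 0) →
        directional (w y) π' = 0 := by
      intro y' π' h1 h2
      have hdvd : π ∣ h a * directional (w y) π' := by
        have e : C (w y a) * mkDerivation K h π' - h a * directional (w y) π' =
            ∑ i, (h i * C (w y a) - C (w y i) * h a) * pderiv i π' := by
          rw [mkDerivation_eq_sum, mkDerivation_eq_sum, Finset.mul_sum, Finset.mul_sum,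
            ← Finset.sum_sub_distrib]
          exact Finset.sum_congr rfl fun i _ => by ring
        rw [hDπ _ _ h1, mul_zero, zero_sub] at e
        rw [← dvd_neg, e]
        exact Finset.dvd_sum fun i _ => (hπ.2.2.2 i).mul_right _
      have := (hπ.2.1.dvd_or_dvd hdvd).resolve_left hπa
      rw [mkDerivation_eq_sum] at this ⊢
      exact directional_eq_zero_of_dvd (totalDegree_ne_zero_of_prime hπ.2.1 hπ.2.2.1)
        (hmax' _ _ h1 h2) this
    obtain ⟨z, hz⟩ : ∃ z, eval z (directional (w y) (h i₀)) ≠ 0 := by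
      by_contra! hz
      exact hi₀ (MvPolynomial.funext fun z => (hz z).trans (map_zero _).symm)
    have hq0 : q z i₀ ≠ 0 := by
      intro h0
      rw [← hqw, h0, map_zero] at hz
      exact hz rfl
    have hE : ∀ i, directional (w y) (h i) * h a = h i * directional (w y) (h a) := by
      intro i
      have : (directional (w y) (h i) * h a - h i * directional (w y) (h a)) * (h a * q z i₀)
          = 0 := by
        refine MvPolynomial.funext fun y' => ?_
        rw [map_zero, map_mul, map_mul]
        by_cases hy' : w y' a = 0
        · rw [show eval y' (h a) = 0 from hy']; ring
        by_cases hq' : eval y' (q z i₀) = 0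
        · rw [hq']; ring
        have hex : ∃ i, directional (w y') (h i) ≠ 0 := by
          refine ⟨i₀, fun h0 => hq' ?_⟩
          rw [hqw, h0, map_zero]
        obtain ⟨π', hπ'⟩ := hFib_ex y' hy'
        obtain ⟨c, hc⟩ := hπ'.2.2.2 i
        have e := congrArg (fun f => eval y' (directional (w y) f)) hc
        simp only [map_sub, Derivation.leibniz, hDw _ _ hπ' hex, derivation_C, smul_eq_mul,
          mul_zero, add_zero, map_zero, map_mul, map_add, hπ'.2.2.1, zero_mul, eval_C] at e
        have e' : eval y' (directional (w y) (h i)) * eval y' (h a) -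
            eval y' (h i) * eval y' (directional (w y) (h a)) = 0 := by
          rw [← e]; simp only [hw]; ring
        rw [map_sub, map_mul, map_mul, e', zero_mul]
      exact sub_eq_zero.1 ((mul_eq_zero.1 this).resolve_right (mul_ne_zero ha hq0))
    have hdvd : h a ∣ directional (w y) (h a) :=
      dvd_of_forall_dvd_mul hprim fun i => ⟨_, (hE i).symm.trans (mul_comm _ _)⟩
    have h0 : directional (w y) (h a) = 0 := by
      rw [mkDerivation_eq_sum] at hdvd ⊢
      exact directional_eq_zero_of_dvd (by rw [(hhom a).totalDegree ha]; omega) le_rfl hdvd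
    have := hE i₀
    rw [h0, mul_zero] at this
    exact hi₀ ((mul_eq_zero.1 this).resolve_right ha)
  have : h a * q z i = 0 := by
    refine MvPolynomial.funext fun y => ?_
    rw [map_zero, map_mul]
    by_cases hy : w y a = 0
    · rw [show eval y (h a) = 0 from hy, zero_mul]
    · rw [hqw, hgood y hy, map_zero, mul_zero]
  exact (mul_eq_zero.1 this).resolve_left ha

theorem pderiv_comm (i j : ι) (f : MvPolynomial ι K) :
    pderiv i (pderiv j f) = pderiv j (pderiv i f) := by
  classical
  have : ⁅pderiv (R := K) i, pderiv (R := K) j⁆ = 0 := by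
    refine derivation_ext fun k => ?_
    rw [Derivation.commutator_apply, pderiv_X, pderiv_X, Pi.single_apply, Pi.single_apply]
    split_ifs <;> simp
  have := DFunLike.congr_fun this f
  rwa [Derivation.commutator_apply, Derivation.zero_apply, sub_eq_zero] at this

theorem eq_zero_of_forall_pderiv_eq_zero [CharZero K] [Fintype ι] {f : MvPolynomial ι K} {m : ℕ}
    (hf : f.IsHomogeneous m) (hm : m ≠ 0) (h : ∀ i, pderiv i f = 0) : f = 0 := by
  have := hf.sum_X_mul_pderiv
  simp only [h, mul_zero, Finset.sum_const_zero, nsmul_eq_mul] at this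
  exact (mul_eq_zero.1 this.symm).resolve_left (Nat.cast_ne_zero.2 hm)

theorem eq_zero_of_mul_pderiv_eq [CharZero K] [Fintype ι] {f p : MvPolynomial ι K} {d : ℕ}
    (hp : p.IsHomogeneous d) {y : ι → K} (hfy : eval y f ≠ 0) (hpy : eval y p = 0)
    (h : ∀ j, f * pderiv j p = p * pderiv j f) : p = 0 := by
  classical
  by_contra hp0
  obtain ⟨π, hπ, hπp, hπy⟩ := exists_prime_dvd_eval_eq_zero hp0 hpy
  have hπf : ¬ π ∣ f := by
    rintro ⟨c, hc⟩
    rw [hc, map_mul, hπy, zero_mul] at hfy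
    exact hfy rfl
  obtain ⟨r, hr, hπr⟩ := (FiniteMultiplicity.of_prime_left hπ hp0).exists_eq_pow_mul_and_not_dvd
  set k := multiplicity π p
  have hk : k ≠ 0 := by
    intro h0
    rw [h0, pow_zero, one_mul] at hr
    exact hπr (hr ▸ hπp)
  obtain ⟨k, hk'⟩ := Nat.exists_eq_succ_of_ne_zero hk
  rw [hk'] at hr
  have hπhom : π.IsHomogeneous π.totalDegree := by
    obtain ⟨c, hc⟩ := hπp
    exact isHomogeneous_of_mul (hc ▸ hp) (hc ▸ hp0)
  have hπdeg := totalDegree_ne_zero_of_prime hπ hπy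
  refine hπ.ne_zero (eq_zero_of_forall_pderiv_eq_zero hπhom hπdeg fun j => ?_)
  have e := h j
  rw [hr, pderiv_mul, pderiv_pow] at e
  have e2 : π ^ k * (((k + 1 : ℕ) : MvPolynomial ι K) * (pderiv j π * (r * f))) =
      π ^ k * (π * (r * pderiv j f - f * pderiv j r)) := by
    rw [Nat.succ_eq_add_one, Nat.add_sub_cancel] at e
    linear_combination e
  have e3 := mul_left_cancel₀ (pow_ne_zero k hπ.ne_zero) e2
  have hC : IsUnit ((k + 1 : ℕ) : MvPolynomial ι K) := by
    have : ((k + 1 : ℕ) : MvPolynomial ι K) = C ((k + 1 : ℕ) : K) := by simp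
    rw [this]
    exact (IsUnit.mk0 _ (Nat.cast_ne_zero.2 k.succ_ne_zero)).map C
  have hdvd : π ∣ pderiv j π * (r * f) := hC.dvd_mul_left.1 ⟨_, e3⟩
  have hdvd' : π ∣ pderiv j π := by
    rcases hπ.dvd_or_dvd hdvd with h1 | h1
    · exact h1
    · exact ((hπ.dvd_or_dvd h1).elim hπr hπf).elim
  have e4 : ∑ i, C ((Pi.single j 1 : ι → K) i) * pderiv i π = pderiv j π := by
    rw [Finset.sum_eq_single_of_mem j (Finset.mem_univ j)]
    · simp
    · intro i _ hij
      simp [hij]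
  rw [← e4] at hdvd' ⊢
  exact directional_eq_zero_of_dvd hπdeg le_rfl hdvd'

theorem exists_eq_C_mul_of_mul_pderiv_eq [CharZero K] [Fintype ι] {f g : MvPolynomial ι K} {d : ℕ}
    (hf : f.IsHomogeneous d) (hg : g.IsHomogeneous d) (hf0 : f ≠ 0)
    (h : ∀ j, f * pderiv j g = g * pderiv j f) : ∃ e : K, g = C e * f := by
  obtain ⟨y, hy⟩ : ∃ y, eval y f ≠ 0 := by
    by_contra! hz
    exact hf0 (MvPolynomial.funext fun z => (hz z).trans (map_zero _).symm)
  refine ⟨eval y g / eval y f, sub_eq_zero.1 ?_⟩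
  refine eq_zero_of_mul_pderiv_eq (hg.sub (hf.C_mul _)) hy ?_ fun j => ?_
  · rw [map_sub, map_mul, eval_C, div_mul_cancel₀ _ hy, sub_self]
  · rw [map_sub, pderiv_C_mul]
    linear_combination h j

/-- A polynomial whose partial derivatives are killed by a primitive homogeneous vector field that
also kills its own components is a cone. -/
theorem exists_cone_of_primitive [IsAlgClosed K] [CharZero K] [Fintype ι]
    (hcard : Fintype.card ι ≤ 4) {h : ι → MvPolynomial ι K}
    (hprim : ∀ c, (∀ i, c ∣ h i) → IsUnit c) (hh : ∀ i, mkDerivation K h (h i) = 0)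
    {d : ℕ} (hhom : ∀ i, (h i).IsHomogeneous d) {F : MvPolynomial ι K} {N : ℕ} (hN : 2 ≤ N)
    (hF : F.IsHomogeneous N) (hDF : ∀ j, mkDerivation K h (pderiv j F) = 0) :
    ∃ v : ι → K, v ≠ 0 ∧ ∑ i, C (v i) * pderiv i F = 0 := by
  classical
  have hF0 : ∑ i, h i * pderiv i F = 0 := by
    have e := congrArg (mkDerivation K h) hF.sum_X_mul_pderiv
    simp only [map_sum, Derivation.leibniz, hDF, smul_eq_mul, mul_zero, zero_add, mkDerivation_X,
      map_nsmul] at e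
    rw [mkDerivation_eq_sum, nsmul_eq_mul] at e
    have e2 : ∑ i, pderiv i F * h i = ∑ i, h i * pderiv i F :=
      Finset.sum_congr rfl fun i _ => mul_comm _ _
    rw [e2] at e
    have e3 : ((N : MvPolynomial ι K) - 1) * ∑ i, h i * pderiv i F = 0 := by
      linear_combination -e
    refine (mul_eq_zero.1 e3).resolve_left (sub_ne_zero.2 ?_)
    exact_mod_cast (by omega : N ≠ 1)
  have hF1 : ∀ j, ∑ i, pderiv j (h i) * pderiv i F = 0 := by
    intro j
    have e := congrArg (pderiv j) hF0
    have e2 := hDF j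
    rw [mkDerivation_eq_sum] at e2
    simp only [map_sum, pderiv_mul, map_zero, Finset.sum_add_distrib, pderiv_comm j _ F, e2,
      add_zero] at e
    exact e
  obtain ⟨a, ha⟩ : ∃ a, h a ≠ 0 := by
    by_contra! h0
    exact not_isUnit_zero (hprim 0 fun i => (h0 i).symm ▸ dvd_rfl)
  rcases Nat.eq_zero_or_pos d with rfl | hd
  · refine ⟨fun i => coeff 0 (h i), fun h0 => ha ?_, ?_⟩
    · rw [totalDegree_eq_zero_iff_eq_C.1 ((totalDegree_zero_iff_isHomogeneous _).2 (hhom a)),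
        show coeff 0 (h a) = 0 from congrFun h0 a, C_0]
    · rw [← hF0]
      refine Finset.sum_congr rfl fun i _ => ?_
      rw [← totalDegree_eq_zero_iff_eq_C.1 ((totalDegree_zero_iff_isHomogeneous _).2 (hhom i))]
  obtain ⟨b, hab⟩ : ∃ b, ∀ e : K, h b ≠ C e * h a := by
    by_contra! hall
    have hu := hprim (h a) fun i => by
      obtain ⟨e, he⟩ := hall i
      exact he ▸ dvd_mul_left _ _
    have := (isUnit_iff_totalDegree_of_isReduced.1 hu).2
    rw [(hhom a).totalDegree ha] at this
    omega
  by_contra! hcone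
  suffices h a ≠ 0 ∧ ∀ j, h a * pderiv j (h b) = h b * pderiv j (h a) by
    obtain ⟨e, he⟩ := exists_eq_C_mul_of_mul_pderiv_eq (hhom a) (hhom b) ha this.2
    exact hab e he
  refine ⟨ha, ?_⟩
  let T : (ι → K) →ₗ[K] MvPolynomial ι K := Fintype.linearCombination K h
  have hT : ∀ γ, T γ = ∑ j, C (γ j) * h j := fun γ => by
    simp [T, Fintype.linearCombination_apply, smul_eq_C_mul]
  have hdim := LinearMap.finrank_range_add_finrank_ker T
  rw [Module.finrank_fintype_fun_eq_card] at hdim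
  by_cases hker : Module.finrank K (LinearMap.ker T) ≤ 1
  · obtain ⟨ρ, hρ⟩ := finrank_le_one_iff.1 hker
    have hminor : ∀ j l, pderiv j (h a) * pderiv l (h b) = pderiv l (h a) * pderiv j (h b) := by
      intro j l
      refine MvPolynomial.funext fun z => ?_
      have hrow : ∀ i, ∃ c : K, ∀ j, eval z (pderiv j (h i)) = c * ρ.1 j := by
        intro i
        have hmem : (fun j => eval z (pderiv j (h i))) ∈ LinearMap.ker T := by
          rw [LinearMap.mem_ker, hT]
          exact sum_eval_pderiv_mul_eq_zero hcard hprim hh hd hhom ha hab z i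
        obtain ⟨c, hc⟩ := hρ ⟨_, hmem⟩
        exact ⟨c, fun j => (congrFun (congrArg Subtype.val hc) j).symm⟩
      obtain ⟨ca, hca⟩ := hrow a
      obtain ⟨cb, hcb⟩ := hrow b
      rw [map_mul, map_mul, hca, hca, hcb, hcb]
      ring
    intro j
    have e : ∑ l, X l * (pderiv j (h a) * pderiv l (h b)) =
        ∑ l, X l * (pderiv l (h a) * pderiv j (h b)) :=
      Finset.sum_congr rfl fun l _ => by rw [hminor]
    have e1 : ∑ l, X l * (pderiv j (h a) * pderiv l (h b)) = pderiv j (h a) * (d • h b) := by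
      rw [← (hhom b).sum_X_mul_pderiv, Finset.mul_sum]
      exact Finset.sum_congr rfl fun l _ => by ring
    have e2 : ∑ l, X l * (pderiv l (h a) * pderiv j (h b)) = (d • h a) * pderiv j (h b) := by
      rw [← (hhom a).sum_X_mul_pderiv, Finset.sum_mul]
      exact Finset.sum_congr rfl fun l _ => by ring
    rw [e1, e2, nsmul_eq_mul, nsmul_eq_mul] at e
    have hd0 : (d : MvPolynomial ι K) ≠ 0 := Nat.cast_ne_zero.2 hd.ne'
    refine mul_left_cancel₀ hd0 ?_
    linear_combination -e
  · have hrange : Module.finrank K (LinearMap.range T) ≤ 2 := by omega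
    have hmem : ∀ i, h i ∈ LinearMap.range T := fun i =>
      ⟨Pi.single i 1, by simp [T]⟩
    have hli : LinearIndependent K ![h a, h b] := by
      rw [LinearIndependent.pair_iff]
      intro s t hst
      rw [smul_eq_C_mul, smul_eq_C_mul] at hst
      have ht : t = 0 := by
        by_contra ht
        refine hab (-s / t) ?_
        have hC : C t ≠ (0 : MvPolynomial ι K) := by simpa using ht
        refine mul_left_cancel₀ hC ?_
        rw [← mul_assoc, ← C_mul, mul_div_cancel₀ _ ht, C_neg]
        linear_combination hst
      subst ht
      rw [C_0, zero_mul, add_zero] at hst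
      exact ⟨by simpa using (mul_eq_zero.1 hst).resolve_right ha, rfl⟩
    have hspan : Submodule.span K {h a, h b} = LinearMap.range T := by
      refine Submodule.eq_of_le_of_finrank_le ?_ ?_
      · rw [Submodule.span_le]
        rintro x (rfl | rfl)
        · exact hmem a
        · exact hmem b
      · have := finrank_span_eq_card hli
        rw [Matrix.range_cons, Matrix.range_cons, Matrix.range_empty, Set.union_empty,
          Set.singleton_union, Fintype.card_fin] at this
        rw [this]
        exact hrange
    have hcomb : ∀ i, ∃ α β : K, C α * h a + C β * h b = h i := by
      intro i
      have := hmem i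
      rw [← hspan, Submodule.mem_span_pair] at this
      simpa only [smul_eq_C_mul] using this
    choose α β hαβ using hcomb
    set Ga := ∑ i, C (α i) * pderiv i F
    set Gb := ∑ i, C (β i) * pderiv i F
    have hGa : Ga ≠ 0 := by
      refine hcone α fun hα => ?_
      have e := hαβ a
      have eb := hαβ b
      simp only [hα, Pi.zero_apply, C_0, zero_mul, zero_add] at e eb
      have h1 : β a ≠ 0 := by
        intro h1
        rw [h1, C_0, zero_mul] at e
        exact ha e.symm
      refine hab (1 / β a) ?_
      rw [← e, ← mul_assoc, ← C_mul, one_div_mul_cancel h1, C_1, one_mul]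
    have e0 : h a * Ga + h b * Gb = 0 := by
      rw [← hF0, Finset.mul_sum, Finset.mul_sum, ← Finset.sum_add_distrib]
      exact Finset.sum_congr rfl fun i _ => by rw [← hαβ i]; ring
    intro j
    have e1 : pderiv j (h a) * Ga + pderiv j (h b) * Gb = 0 := by
      rw [← hF1 j, Finset.mul_sum, Finset.mul_sum, ← Finset.sum_add_distrib]
      refine Finset.sum_congr rfl fun i _ => ?_
      rw [← hαβ i, map_add, pderiv_C_mul, pderiv_C_mul]
      ring
    refine mul_right_cancel₀ hGa ?_
    linear_combination pderiv j (h b) * e0 - h b * e1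

theorem exists_eq_mul_primitive [Fintype ι] {h : ι → MvPolynomial ι K} {a : ι} (ha : h a ≠ 0) :
    ∃ (c : MvPolynomial ι K) (g : ι → MvPolynomial ι K), c ≠ 0 ∧ (∀ i, h i = c * g i) ∧
      ∀ x, (∀ i, x ∣ g i) → IsUnit x := by
  classical
  let _ := UniqueFactorizationMonoid.strongNormalizationMonoid (α := MvPolynomial ι K)
  let _ := UniqueFactorizationMonoid.toNormalizedGCDMonoid (MvPolynomial ι K)
  obtain ⟨g, hg, hg1⟩ := Finset.extract_gcd h (s := Finset.univ) ⟨a, Finset.mem_univ a⟩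
  refine ⟨Finset.univ.gcd h, g, ?_, fun i => hg i (Finset.mem_univ i), fun x hx => ?_⟩
  · intro h0
    exact ha (by rw [hg a (Finset.mem_univ a), h0, zero_mul])
  · exact isUnit_of_dvd_one (hg1 ▸ Finset.dvd_gcd fun i _ => hx i)

/-- **Gordan–Noether**: a form in at most four variables with vanishing Hessian is a cone. -/
theorem exists_cone_of_hessian_kernel [IsAlgClosed K] [CharZero K] [Fintype ι]
    (hcard : Fintype.card ι ≤ 4) {F : MvPolynomial ι K} {N : ℕ} (hN : 2 ≤ N)
    (hF : F.IsHomogeneous N) {u : ι → MvPolynomial ι K} (hu : u ≠ 0)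
    (hker : ∀ j, ∑ i, u i * pderiv i (pderiv j F) = 0) :
    ∃ v : ι → K, v ≠ 0 ∧ ∑ i, C (v i) * pderiv i F = 0 := by
  classical
  have hFhom : ∀ j, (pderiv j F).IsHomogeneous (N - 1) := fun j => hF.pderiv
  have hdep : ¬ AlgebraicIndependent K fun j => pderiv j F := by
    intro hind
    refine hu (funext fun i => ?_)
    have := derivation_eq_zero_of_algebraicIndependent hind (mkDerivation K u)
      (fun j => by rw [mkDerivation_eq_sum]; exact hker j) (X i)
    rwa [mkDerivation_X] at this
  have hrel := exists_isHomogeneous_relation (by omega : 0 < N - 1) hFhom hdep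
  obtain ⟨g, hg, hg0, hgF⟩ := Nat.find_spec hrel
  set m := Nat.find hrel with hm
  have hm0 : m ≠ 0 := by
    intro h0
    rw [h0] at hg
    rw [totalDegree_eq_zero_iff_eq_C.1 ((totalDegree_zero_iff_isHomogeneous _).2 hg), aeval_C] at hgF
    refine hg0 ?_
    rw [totalDegree_eq_zero_iff_eq_C.1 ((totalDegree_zero_iff_isHomogeneous _).2 hg),
      (FaithfulSMul.algebraMap_injective K (MvPolynomial ι K)) (hgF.trans (map_zero _).symm), C_0]
  set k : ι → MvPolynomial ι K := fun i => aeval (fun j => pderiv j F) (pderiv i g) with hk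
  have hkhom : ∀ i, (k i).IsHomogeneous ((N - 1) * (m - 1)) := fun i =>
    hg.pderiv.aeval _ hFhom
  obtain ⟨a, ha⟩ : ∃ a, k a ≠ 0 := by
    by_contra! h0
    refine hg0 (eq_zero_of_forall_pderiv_eq_zero hg hm0 fun i => ?_)
    by_contra hi
    exact Nat.find_min hrel (m := m - 1) (by omega) ⟨_, hg.pderiv, hi, h0 i⟩
  have hkF : ∀ j, mkDerivation K k (pderiv j F) = 0 := by
    intro j
    have e := derivation_aeval (pderiv j) (fun j => pderiv j F) g
    rw [hgF, map_zero] at e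
    rw [mkDerivation_eq_sum, e]
    exact Finset.sum_congr rfl fun i _ => by rw [pderiv_comm]
  have hkk : ∀ i, mkDerivation K k (k i) = 0 := by
    intro i
    rw [show k i = aeval (fun j => pderiv j F) (pderiv i g) from rfl, derivation_aeval]
    exact Finset.sum_eq_zero fun j _ => by rw [hkF, mul_zero]
  obtain ⟨c, h, hc, hkh, hprim⟩ := exists_eq_mul_primitive ha
  have hDk : ∀ f, mkDerivation K k f = c * mkDerivation K h f := by
    intro f
    rw [mkDerivation_eq_sum, mkDerivation_eq_sum, Finset.mul_sum]
    exact Finset.sum_congr rfl fun i _ => by rw [hkh]; ring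
  have hD : ∀ f, mkDerivation K k f = 0 → mkDerivation K h f = 0 := fun f hf =>
    (mul_eq_zero.1 ((hDk f).symm.trans hf)).resolve_left hc
  have hh : ∀ i, mkDerivation K h (h i) = 0 := by
    intro i
    by_cases hi : h i = 0
    · rw [hi, map_zero]
    · refine hD _ (derivation_eq_zero_of_dvd hkk (hkk i) ?_ ⟨c, ?_⟩)
      · rw [hkh]
        exact mul_ne_zero hc hi
      · rw [hkh, mul_comm]
  have hhom : ∀ i, (h i).IsHomogeneous ((N - 1) * (m - 1) - c.totalDegree) := by
    intro i
    by_cases hi : h i = 0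
    · rw [hi]
      exact isHomogeneous_zero _ _ _
    have hne : h i * c ≠ 0 := mul_ne_zero hi hc
    have e : (h i * c).IsHomogeneous ((N - 1) * (m - 1)) := by
      rw [mul_comm, ← hkh]
      exact hkhom i
    have e2 := e.totalDegree hne
    rw [totalDegree_mul_of_isDomain hi hc] at e2
    rw [← e2, Nat.add_sub_cancel]
    exact isHomogeneous_of_mul e hne
  exact exists_cone_of_primitive hcard hprim hh hhom hN hF fun j => hD _ (hkF j)

section MapCoeff

variable {R : Type*} [CommRing R] [Algebra K R]

/-- A linear map applied to every coefficient of a polynomial. -/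
noncomputable def mapCoeff (φ : R →ₗ[K] K) : MvPolynomial ι R →ₗ[K] MvPolynomial ι K where
  toFun P := ∑ m ∈ P.support, monomial m (φ (coeff m P))
  map_add' P Q := by
    classical
    ext m
    simp only [coeff_add, coeff_sum, coeff_monomial, Finset.sum_ite_eq', mem_support_iff]
    split_ifs <;> simp_all
    · rename_i h h1 h2
      rw [eq_neg_of_add_eq_zero_right h]
      simp
  map_smul' c P := by
    classical
    ext m
    simp only [coeff_smul, coeff_sum, coeff_monomial, Finset.sum_ite_eq', mem_support_iff,
      RingHom.id_apply]
    split_ifs <;> simp_all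

@[simp]
theorem coeff_mapCoeff (φ : R →ₗ[K] K) (P : MvPolynomial ι R) (m : ι →₀ ℕ) :
    coeff m (mapCoeff φ P) = φ (coeff m P) := by
  classical
  change coeff m (∑ m ∈ P.support, monomial m (φ (coeff m P))) = _
  simp only [coeff_sum, coeff_monomial, Finset.sum_ite_eq', mem_support_iff]
  split_ifs <;> simp_all

theorem pderiv_mapCoeff (φ : R →ₗ[K] K) (P : MvPolynomial ι R) (i : ι) :
    pderiv i (mapCoeff φ P) = mapCoeff φ (pderiv i P) := by
  ext m
  rw [coeff_pderiv, coeff_mapCoeff, coeff_mapCoeff, coeff_pderiv]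
  have e : coeff (m + Finsupp.single i 1) P * ((m i : R) + 1)
      = ((m i : K) + 1) • coeff (m + Finsupp.single i 1) P := by
    rw [Algebra.smul_def, map_add, map_one, map_natCast, mul_comm]
  rw [e, map_smul, smul_eq_mul, mul_comm]

theorem isHomogeneous_mapCoeff (φ : R →ₗ[K] K) {P : MvPolynomial ι R} {n : ℕ}
    (hP : P.IsHomogeneous n) : (mapCoeff φ P).IsHomogeneous n := by
  intro m hm
  refine hP fun h => hm ?_
  rw [coeff_mapCoeff, h, map_zero]

theorem mapCoeff_monomial (φ : R →ₗ[K] K) (m : ι →₀ ℕ) (r : R) :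
    mapCoeff φ (monomial m r) = monomial m (φ r) := by
  classical
  ext n
  rw [coeff_mapCoeff, coeff_monomial, coeff_monomial]
  split_ifs
  · rfl
  · exact map_zero φ

theorem eval_mapCoeff (φ : R →ₗ[K] K) (P : MvPolynomial ι R) (x : ι → K) :
    eval x (mapCoeff φ P) = φ (eval (fun i => algebraMap K R (x i)) P) := by
  induction P using MvPolynomial.induction_on' with
  | add P Q hP hQ => rw [map_add, map_add, map_add, map_add, hP, hQ]
  | monomial m r =>
    rw [mapCoeff_monomial, eval_monomial, eval_monomial]
    have e : (m.prod fun i k => algebraMap K R (x i) ^ k)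
        = algebraMap K R (m.prod fun i k => x i ^ k) := by
      simp only [Finsupp.prod, map_prod, map_pow]
    rw [e, mul_comm r, ← Algebra.smul_def, map_smul, smul_eq_mul, mul_comm]

variable [Fintype ι]

/-- The generic linear combination of the vectors `e i`, as a linear form. -/
noncomputable def genericForm (e : ι → R) : MvPolynomial ι R := ∑ i, C (e i) * X i

theorem isHomogeneous_genericForm (e : ι → R) : (genericForm e).IsHomogeneous 1 :=
  IsHomogeneous.sum _ _ _ fun i _ => by
    simpa using (isHomogeneous_C ι (e i)).mul (isHomogeneous_X R i)

theorem eval_genericForm (e : ι → R) (x : ι → K) :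
    eval (fun i => algebraMap K R (x i)) (genericForm e) = ∑ i, x i • e i := by
  simp only [genericForm, map_sum, map_mul, eval_C, eval_X]
  exact Finset.sum_congr rfl fun i _ => by rw [Algebra.smul_def, mul_comm]

theorem pderiv_genericForm (e : ι → R) (i : ι) : pderiv i (genericForm e) = C (e i) := by
  classical
  simp [genericForm, pderiv_X, Pi.single_apply]

theorem pderiv_mapCoeff_pow (φ : R →ₗ[K] K) (e : ι → R) (r : R) (k : ℕ) (i : ι) :
    pderiv i (mapCoeff φ (C r * genericForm e ^ (k + 1)))
      = (k + 1 : K) • mapCoeff φ (C (r * e i) * genericForm e ^ k) := by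
  rw [pderiv_mapCoeff, ← map_smul]
  congr 1
  rw [pderiv_C_mul, pderiv_pow, pderiv_genericForm, Nat.add_sub_cancel, C_mul,
    ← Nat.cast_add_one, Nat.cast_smul_eq_nsmul, nsmul_eq_mul]
  ring

/-- If all directional derivatives of order `k` annihilate `r` under `φ`, then `r` is
orthogonal to all products of `k` elements in the span of the `e i`. -/
theorem eq_zero_of_mapCoeff_pow_eq_zero [CharZero K] (φ : R →ₗ[K] K) (e : ι → R)
    (k : ℕ) : ∀ r : R, mapCoeff φ (C r * genericForm e ^ k) = 0 →
      ∀ s ∈ Submodule.span K (Set.range e) ^ k, φ (r * s) = 0 := by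
  induction k with
  | zero =>
    intro r hr s hs
    rw [pow_zero, Submodule.mem_one] at hs
    obtain ⟨c, rfl⟩ := hs
    have h := congrArg (coeff 0) hr
    rw [coeff_mapCoeff, pow_zero, mul_one, coeff_zero_C, coeff_zero] at h
    rw [mul_comm, ← Algebra.smul_def, map_smul, h, smul_zero]
  | succ k ih =>
    intro r hr s hs
    rw [pow_succ'] at hs
    have key : ∀ i, ∀ t ∈ Submodule.span K (Set.range e) ^ k, φ (r * e i * t) = 0 := by
      intro i
      refine ih _ ?_
      have h := pderiv_mapCoeff_pow φ e r k i
      rw [hr, map_zero] at h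
      exact (smul_eq_zero.1 h.symm).resolve_left (Nat.cast_add_one_ne_zero k)
    induction hs using Submodule.mul_induction_on' with
    | add x _ y _ hx hy => rw [mul_add, map_add, hx, hy, add_zero]
    | mem_mul_mem a ha t ht =>
      induction ha using Submodule.span_induction with
      | mem a ha =>
        obtain ⟨i, rfl⟩ := ha
        rw [← mul_assoc]
        exact key i t ht
      | zero => rw [zero_mul, mul_zero, map_zero]
      | add a b _ _ ha hb => rw [add_mul, mul_add, map_add, ha, hb, add_zero]
      | smul c a _ ha => rw [smul_mul_assoc, mul_smul_comm, map_smul, ha, smul_zero]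

/-- If multiplication by the `n`-th power of every element of the span of the `e i` is degenerate
on that span, then some element of the span annihilates all products of `n + 1` elements. -/
theorem exists_annihilator_of_degenerate [IsAlgClosed K] [CharZero K]
    (hcard : Fintype.card ι ≤ 4) (φ : R →ₗ[K] K) (e : ι → R) (n : ℕ)
    (hdeg : ∀ x : ι → K, ∃ y : ι → K, y ≠ 0 ∧ (∑ i, x i • e i) ^ n * (∑ i, y i • e i) = 0) :
    ∃ v : ι → K, v ≠ 0 ∧
      ∀ s ∈ Submodule.span K (Set.range e) ^ (n + 1), φ ((∑ i, v i • e i) * s) = 0 := by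
  classical
  set F : MvPolynomial ι K := mapCoeff φ (C 1 * genericForm e ^ (n + 2)) with hF
  have hd1 : ∀ i, pderiv i F
      = (n + 2 : K) • mapCoeff φ (C (e i) * genericForm e ^ (n + 1)) := by
    intro i
    rw [hF, pderiv_mapCoeff_pow, one_mul]
    congr 1
    push_cast
    ring
  have hd2 : ∀ i j, pderiv i (pderiv j F)
      = ((n + 2 : K) * (n + 1)) • mapCoeff φ (C (e j * e i) * genericForm e ^ n) := by
    intro i j
    rw [hd1, Derivation.map_smul, pderiv_mapCoeff_pow, smul_smul]
  have hFhom : F.IsHomogeneous (n + 2) := by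
    refine isHomogeneous_mapCoeff φ ?_
    rw [C_1, one_mul]
    simpa using (isHomogeneous_genericForm e).pow (n + 2)
  set H : Matrix ι ι (MvPolynomial ι K) := Matrix.of fun j i => pderiv i (pderiv j F) with hH
  have hdet : H.det = 0 := by
    refine MvPolynomial.funext fun x => ?_
    rw [RingHom.map_det, map_zero]
    obtain ⟨y, hy, hxy⟩ := hdeg x
    refine Matrix.exists_mulVec_eq_zero_iff.1 ⟨y, hy, ?_⟩
    funext j
    have e1 : ∀ i, eval x (pderiv i (pderiv j F)) * y i
        = ((n + 2 : K) * (n + 1)) * φ (e j * ((∑ i, x i • e i) ^ n * (y i • e i))) := by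
      intro i
      rw [hd2, smul_eval, eval_mapCoeff, map_mul, eval_C, map_pow, eval_genericForm, mul_assoc]
      congr 1
      rw [mul_comm, ← smul_eq_mul, ← map_smul]
      congr 1
      rw [mul_smul_comm, mul_smul_comm]
      congr 1
      ring
    simp only [hH, Matrix.mulVec, dotProduct, RingHom.mapMatrix_apply, Matrix.map_apply,
      Matrix.of_apply, e1, Pi.zero_apply]
    rw [← Finset.mul_sum, ← map_sum, ← Finset.mul_sum, ← Finset.mul_sum, hxy, mul_zero, map_zero,
      mul_zero]
  obtain ⟨u, hu, hHu⟩ := Matrix.exists_mulVec_eq_zero_iff.2 hdet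
  obtain ⟨v, hv, hvF⟩ := exists_cone_of_hessian_kernel hcard (Nat.le_add_left 2 n) hFhom hu
    fun j => by
      have := congrFun hHu j
      simp only [hH, Matrix.mulVec, dotProduct, Matrix.of_apply, Pi.zero_apply] at this
      rw [← this]
      exact Finset.sum_congr rfl fun i _ => mul_comm _ _
  refine ⟨v, hv, eq_zero_of_mapCoeff_pow_eq_zero φ e (n + 1) _ ?_⟩
  have e2 : ∑ i, C (v i) * pderiv i F
      = (n + 2 : K) • mapCoeff φ (C (∑ i, v i • e i) * genericForm e ^ (n + 1)) := by
    have e3 : C (∑ i, v i • e i) * genericForm e ^ (n + 1)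
        = ∑ i, v i • (C (e i) * genericForm e ^ (n + 1)) := by
      rw [map_sum, Finset.sum_mul]
      refine Finset.sum_congr rfl fun i _ => ?_
      rw [← smul_mul_assoc, C_apply, C_apply, smul_monomial]
    rw [e3, map_sum, Finset.smul_sum]
    refine Finset.sum_congr rfl fun i _ => ?_
    rw [hd1, map_smul, ← smul_eq_C_mul, smul_comm]
  rw [e2] at hvF
  refine (smul_eq_zero.1 hvF).resolve_left ?_
  exact_mod_cast (Nat.succ_ne_zero (n + 1))

end MapCoeff

/-- A graded algebra generated in degree one has its degree `k` part spanned by products of `k`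
elements of degree one. -/
theorem graded_le_pow {R : Type*} [CommRing R] [Algebra K R] (𝒜 : ℕ → Submodule K R)
    [GradedAlgebra 𝒜] (hgen : Algebra.adjoin K (𝒜 1 : Set R) = ⊤) (k : ℕ) :
    𝒜 k ≤ 𝒜 1 ^ k := by
  have key : ∀ r : R, ∀ k, (DirectSum.decompose 𝒜 r k : R) ∈ 𝒜 1 ^ k := by
    intro r
    have hr : r ∈ Algebra.adjoin K (𝒜 1 : Set R) := hgen ▸ Algebra.mem_top
    induction hr using Algebra.adjoin_induction with
    | mem x hx =>
      intro k
      by_cases hk : 1 = k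
      · subst hk
        rw [DirectSum.decompose_of_mem_same 𝒜 hx, pow_one]
        exact hx
      · rw [DirectSum.decompose_of_mem_ne 𝒜 hx hk]
        exact zero_mem _
    | algebraMap c =>
      intro k
      have hx : algebraMap K R c ∈ 𝒜 0 := SetLike.algebraMap_mem_graded 𝒜 c
      by_cases hk : 0 = k
      · subst hk
        rw [DirectSum.decompose_of_mem_same 𝒜 hx, pow_zero]
        exact Submodule.algebraMap_mem c
      · rw [DirectSum.decompose_of_mem_ne 𝒜 hx hk]
        exact zero_mem _
    | add x y _ _ hx hy =>
      intro k
      rw [DirectSum.decompose_add, DirectSum.add_apply, Submodule.coe_add]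
      exact add_mem (hx k) (hy k)
    | mul x y _ _ hx hy =>
      intro k
      rw [DirectSum.decompose_mul, DirectSum.coe_mul_apply_eq_sum_antidiagonal]
      refine sum_mem fun p hp => ?_
      rw [← Finset.HasAntidiagonal.mem_antidiagonal.1 hp, pow_add]
      exact Submodule.mul_mem_mul (hx _) (hy _)
  intro r hr
  have h := key r k
  rwa [DirectSum.decompose_of_mem_same 𝒜 hr] at h

end GordanNoether

/-- **Theorem B.** Every standard Artinian Gorenstein algebra of codimension at most `4`
over an algebraically closed field of characteristic `0` satisfies the strong Lefschetz
property in degree `1`: there is `x ∈ R¹` such that multiplication by `x^(N-2)` is an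
isomorphism `R¹ → R^(N-1)`.  Here the SAGA is encoded as a graded algebra `R` with grading
`𝒜`, finite dimensional pieces vanishing above the socle degree `N`, with `𝒜 0 = K`,
one-dimensional socle, generated in degree `1`, and satisfying Gorenstein duality
(the multiplication pairings `𝒜 i × 𝒜 (N - i) → 𝒜 N` are nondegenerate). -/
theorem slp_degree_one_of_codim_le_four
    {K : Type*} [Field K] [IsAlgClosed K] [CharZero K]
    {R : Type*} [CommRing R] [Algebra K R]
    (𝒜 : ℕ → Submodule K R) [GradedAlgebra 𝒜] (N : ℕ) (hN : 2 ≤ N)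
    (hfin : ∀ i, FiniteDimensional K (𝒜 i))
    (htop : ∀ i, N < i → 𝒜 i = ⊥)
    (h0 : Module.finrank K (𝒜 0) = 1)
    (hsoc : Module.finrank K (𝒜 N) = 1)
    (hgen : Algebra.adjoin K (𝒜 1 : Set R) = ⊤)
    (hdual : ∀ i ≤ N, ∀ x ∈ 𝒜 i, x ≠ 0 → ∃ y ∈ 𝒜 (N - i), x * y ≠ 0)
    (hcodim : Module.finrank K (𝒜 1) ≤ 4) :
    ∃ x ∈ 𝒜 1,
      (∀ y ∈ 𝒜 1, x ^ (N - 2) * y = 0 → y = 0) ∧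
      (∀ z ∈ 𝒜 (N - 1), ∃ y ∈ 𝒜 1, x ^ (N - 2) * y = z) := by
  obtain ⟨n, rfl⟩ := Nat.exists_eq_add_of_le' hN
  rw [show n + 2 - 1 = n + 1 from rfl, show n + 2 - 2 = n from rfl]
  have := hfin 1
  have := hfin (n + 1)
  have := hfin (n + 2)
  have hmul : ∀ {i j : ℕ} {x y : R}, x ∈ 𝒜 i → y ∈ 𝒜 j → x * y ∈ 𝒜 (i + j) :=
    fun hx hy => SetLike.mul_mem_graded hx hy
  obtain ⟨φ, hφ⟩ : ∃ φ : R →ₗ[K] K, ∀ s ∈ 𝒜 (n + 2), φ s = 0 → s = 0 := by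
    let ψ : 𝒜 (n + 2) ≃ₗ[K] K :=
      LinearEquiv.ofFinrankEq _ _ (hsoc.trans (Module.finrank_self K).symm)
    obtain ⟨φ, hφ⟩ := LinearMap.exists_extend (ψ : 𝒜 (n + 2) →ₗ[K] K)
    refine ⟨φ, fun s hs h => ?_⟩
    have h1 : ψ ⟨s, hs⟩ = 0 := by
      rw [← h]
      exact (LinearMap.congr_fun hφ ⟨s, hs⟩).symm
    exact congrArg Subtype.val (ψ.map_eq_zero_iff.1 h1)
  let b := Module.finBasis K (𝒜 1)
  let e : Fin (Module.finrank K (𝒜 1)) → R := fun i => b i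
  have hcoe : ∀ x : Fin (Module.finrank K (𝒜 1)) → K,
      ∑ i, x i • e i = (b.equivFun.symm x : R) := by
    intro x
    rw [b.equivFun_symm_apply]
    simp [e]
  have hspan : Submodule.span K (Set.range e) = 𝒜 1 := by
    rw [show Set.range e = (𝒜 1).subtype '' Set.range b by
      rw [← Set.range_comp]
      rfl, Submodule.span_image, b.span_eq, Submodule.map_subtype_top]
  obtain ⟨x, hx, hinj⟩ : ∃ x ∈ 𝒜 1, ∀ y ∈ 𝒜 1, x ^ n * y = 0 → y = 0 := by
    by_contra! hcon
    obtain ⟨v, hv, hann⟩ := GordanNoether.exists_annihilator_of_degenerate (ι := Fin _)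
      ((Fintype.card_fin _).trans_le hcodim) φ e n fun x => by
        obtain ⟨y, hy, hxy, hy0⟩ := hcon _ (b.equivFun.symm x).2
        refine ⟨b.equivFun ⟨y, hy⟩, fun h => hy0 ?_, ?_⟩
        · exact congrArg Subtype.val (b.equivFun.map_eq_zero_iff.1 h)
        · rw [hcoe, hcoe, LinearEquiv.symm_apply_apply]
          exact hxy
    rw [hcoe, hspan] at hann
    obtain ⟨s, hs, hne⟩ := hdual 1 (Nat.le_add_left 1 (n + 1)) _ (b.equivFun.symm v).2 fun h =>
      hv (b.equivFun.symm.map_eq_zero_iff.1 (Subtype.ext h))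
    refine hne (hφ _ ?_ (hann s (GordanNoether.graded_le_pow 𝒜 hgen _ hs)))
    have h := hmul (b.equivFun.symm v).2 hs
    rwa [show 1 + (n + 2 - 1) = n + 2 by lia] at h
  refine ⟨x, hx, hinj, ?_⟩
  have hxn : ∀ y ∈ 𝒜 1, x ^ n * y ∈ 𝒜 (n + 1) := fun y hy => by
    have h := SetLike.pow_mem_graded (A := 𝒜) n hx
    rw [smul_eq_mul, mul_one] at h
    exact hmul h hy
  let f : 𝒜 1 →ₗ[K] 𝒜 (n + 1) := (LinearMap.mulLeft K (x ^ n)).restrict hxn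
  have hf : Function.Injective f := by
    rw [injective_iff_map_eq_zero]
    intro y hy
    exact Subtype.ext (hinj y y.2 (congrArg Subtype.val hy))
  let g : 𝒜 (n + 1) →ₗ[K] Module.Dual K (𝒜 1) :=
    (((LinearMap.mul K R).compr₂ φ).domRestrict₁₂ (𝒜 (n + 1)) (𝒜 1))
  have hg : Function.Injective g := by
    rw [injective_iff_map_eq_zero]
    intro z hz
    by_contra hne
    obtain ⟨y, hy, hzy⟩ := hdual (n + 1) (Nat.le_succ _) z z.2 fun h => hne (Subtype.ext h)
    rw [show n + 2 - (n + 1) = 1 by lia] at hy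
    exact hzy (hφ _ (hmul (i := n + 1) z.2 hy) (LinearMap.congr_fun hz ⟨y, hy⟩))
  have hle := LinearMap.finrank_le_finrank_of_injective hg
  rw [Subspace.dual_finrank_eq] at hle
  have hsurj := (LinearMap.injective_iff_surjective_of_finrank_eq_finrank
    (le_antisymm (LinearMap.finrank_le_finrank_of_injective hf) hle)).1 hf
  intro z hz
  obtain ⟨y, hy⟩ := hsurj ⟨z, hz⟩
  exact ⟨y, y.2, congrArg Subtype.val hy⟩
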